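/- arXiv:2312.00234 — 3 statements merged into one kernel-verified Lean document; each statement's English description precedes it below -/
import Mathlib

section
/- Let H be a real Hilbert space and let F : H → H be Fréchet differentiable with derivative F'(u) at each u ∈ H. Let 0 < λ ≤ Λ be real constants such that for all u, v ∈ H one has ⟪F'(u) v, v⟫ ≥ λ‖v‖² and ‖F'(u) − F'(v)‖ ≤ Λ‖u − v‖ (operator norm), and suppose that for each u ∈ H the derivative F'(u) is a continuous linear equivalence of H (i.e., there is a family N(u) : H ≃L[ℝ] H with N(u) = F'(u) as a map). Fix f ∈ H and u* ∈ H with F(u*) = f, fix u₀ ∈ H, and define the Newton iterates u_{t+1} = u_t − N(u_t)⁻¹(F(u_t) − f). Set q = Λ/(2λ²) and r = ‖F(u₀) − f‖, and assume q·r < 1. Then for every ε > 0 and every T ∈ ℕ such that (q·r)^(2^T) ≤ λ·q·ε, one has ‖u_T − u*‖ ≤ ε. -/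
open scoped RealInnerProductSpace

/-- Second-order Taylor bound for a map whose derivative is Lipschitz. -/
theorem norm_taylor_remainder_le_of_lipschitz_fderiv
    {E G : Type*} [NormedAddCommGroup E] [NormedSpace ℝ E]
    [NormedAddCommGroup G] [NormedSpace ℝ G]
    {F : E → G} {F' : E → E →L[ℝ] G} (hF : ∀ u, HasFDerivAt F (F' u) u)
    {L : ℝ} (hLip : ∀ u v, ‖F' u - F' v‖ ≤ L * ‖u - v‖) (x h : E) :
    ‖F (x + h) - F x - F' x h‖ ≤ L / 2 * ‖h‖ ^ 2 := by
  have hg (s : ℝ) : HasDerivAt (fun s : ℝ ↦ F (x + s • h) - F x - s • F' x h)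
      (F' (x + s • h) h - F' x h) s := by
    have hline : HasDerivAt (fun s : ℝ ↦ x + s • h) h s := by
      simpa using ((hasDerivAt_id s).smul_const h).const_add x
    have hlin : HasDerivAt (fun s : ℝ ↦ s • F' x h) (F' x h) s := by
      simpa using (hasDerivAt_id s).smul_const (F' x h)
    exact (((hF (x + s • h)).comp_hasDerivAt s hline).sub_const (F x)).sub hlin
  have hB (s : ℝ) : HasDerivAt (fun s : ℝ ↦ L / 2 * ‖h‖ ^ 2 * s ^ 2) (L * ‖h‖ ^ 2 * s) s := by
    refine ((hasDerivAt_pow 2 s).const_mul (L / 2 * ‖h‖ ^ 2)).congr_deriv ?_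
    push_cast
    ring
  have key := image_norm_le_of_norm_deriv_right_le_deriv_boundary (a := 0) (b := 1)
    (fun s _ ↦ (hg s).continuousAt.continuousWithinAt) (fun s _ ↦ (hg s).hasDerivWithinAt)
    (by simp) hB (fun s hs ↦ ?_) (Set.right_mem_Icc.2 zero_le_one)
  · simpa using key
  · calc ‖F' (x + s • h) h - F' x h‖ = ‖(F' (x + s • h) - F' x) h‖ := by simp
      _ ≤ ‖F' (x + s • h) - F' x‖ * ‖h‖ := ContinuousLinearMap.le_opNorm _ _
      _ ≤ L * ‖x + s • h - x‖ * ‖h‖ := by gcongr; exact hLip _ _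
      _ = L * ‖h‖ ^ 2 * s := by
        rw [add_sub_cancel_left, norm_smul, Real.norm_of_nonneg hs.1]
        ring

/-- A lower bound by a positive quadratic form yields a lower bound in norm. -/
theorem mul_norm_le_norm_of_mul_sq_le_inner
    {H : Type*} [NormedAddCommGroup H] [InnerProductSpace ℝ H] {c : ℝ} {w v : H}
    (h : c * ‖v‖ ^ 2 ≤ ⟪w, v⟫) : c * ‖v‖ ≤ ‖w‖ := by
  rcases (norm_nonneg v).eq_or_lt with hv | hv
  · simp [← hv]
  · refine le_of_mul_le_mul_right ?_ hv
    linarith [real_inner_le_norm w v]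

/-- A map with uniformly coercive derivative is strongly monotone. -/
theorem mul_sq_norm_sub_le_inner_of_coercive_fderiv
    {H : Type*} [NormedAddCommGroup H] [InnerProductSpace ℝ H]
    {F : H → H} {F' : H → H →L[ℝ] H} (hF : ∀ u, HasFDerivAt F (F' u) u)
    {c : ℝ} (hcoer : ∀ u v, c * ‖v‖ ^ 2 ≤ ⟪F' u v, v⟫) (x y : H) :
    c * ‖x - y‖ ^ 2 ≤ ⟪F x - F y, x - y⟫ := by
  set h := x - y with hh
  have hφ (s : ℝ) : HasDerivAt (fun s : ℝ ↦ ⟪F (y + s • h), h⟫ - s * (c * ‖h‖ ^ 2))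
      (⟪F' (y + s • h) h, h⟫ - c * ‖h‖ ^ 2) s := by
    have hline : HasDerivAt (fun s : ℝ ↦ y + s • h) h s := by
      simpa using ((hasDerivAt_id s).smul_const h).const_add y
    have hinner := ((hF (y + s • h)).comp_hasDerivAt s hline).inner ℝ (hasDerivAt_const s h)
    have hlin := (hasDerivAt_id s).mul_const (c * ‖h‖ ^ 2)
    refine (hinner.sub hlin).congr_deriv ?_
    simp
  have hmono := monotone_of_hasDerivAt_nonneg hφ
    (fun s ↦ sub_nonneg.2 (hcoer (y + s • h) h)) zero_le_one
  have hx : y + h = x := by simp [hh]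
  simp only [zero_smul, add_zero, zero_mul, sub_zero, one_smul, one_mul, hx] at hmono
  rw [inner_sub_left]
  linarith

/-- Doubly exponential convergence of Newton's method (paper's Lemma 1). -/
theorem newton_convergence
    {H : Type*} [NormedAddCommGroup H] [InnerProductSpace ℝ H] [CompleteSpace H]
    (F : H → H) (F' : H → H →L[ℝ] H)
    (hF : ∀ u : H, HasFDerivAt F (F' u) u)
    (lam Lam : ℝ) (hlam : 0 < lam) (hlamLam : lam ≤ Lam)
    (hcoer : ∀ u v : H, lam * ‖v‖ ^ 2 ≤ ⟪F' u v, v⟫)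
    (hLip : ∀ u v : H, ‖F' u - F' v‖ ≤ Lam * ‖u - v‖)
    (N : H → (H ≃L[ℝ] H)) (hN : ∀ u : H, ((N u : H ≃L[ℝ] H) : H →L[ℝ] H) = F' u)
    (f uStar : H) (hfix : F uStar = f)
    (u₀ : H) (u : ℕ → H) (hu0 : u 0 = u₀)
    (hstep : ∀ t : ℕ, u (t + 1) = u t - (N (u t)).symm (F (u t) - f))
    (q r : ℝ) (hq : q = Lam / (2 * lam ^ 2)) (hr : r = ‖F u₀ - f‖)
    (hqr : q * r < 1) :
    ∀ ε > (0 : ℝ), ∀ T : ℕ, (q * r) ^ (2 ^ T) ≤ lam * q * ε → ‖u T - uStar‖ ≤ ε := by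
  have hLam : 0 < Lam := hlam.trans_le hlamLam
  have hq0 : 0 < q := by rw [hq]; positivity
  have hres (t : ℕ) : ‖F (u (t + 1)) - f‖ ≤ q * ‖F (u t) - f‖ ^ 2 := by
    set d := (N (u t)).symm (F (u t) - f) with hd
    have hNd : F' (u t) d = F (u t) - f := by
      rw [← hN]
      exact (N (u t)).apply_symm_apply _
    have hdn : lam * ‖d‖ ≤ ‖F (u t) - f‖ := by
      rw [← hNd]
      exact mul_norm_le_norm_of_mul_sq_le_inner (hcoer _ _)
    have htaylor := norm_taylor_remainder_le_of_lipschitz_fderiv hF hLip (u t) (-d)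
    rw [map_neg, hNd, norm_neg, ← sub_eq_add_neg, ← hstep] at htaylor
    calc ‖F (u (t + 1)) - f‖ = ‖F (u (t + 1)) - F (u t) - -(F (u t) - f)‖ := by
          congr 1; abel
      _ ≤ Lam / 2 * ‖d‖ ^ 2 := htaylor
      _ = q * (lam * ‖d‖) ^ 2 := by rw [hq]; field_simp
      _ ≤ q * ‖F (u t) - f‖ ^ 2 := by gcongr
  have hdecay (t : ℕ) : q * ‖F (u t) - f‖ ≤ (q * r) ^ (2 ^ t) := by
    induction t with
    | zero => simp [hu0, hr]
    | succ t ih =>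
      calc q * ‖F (u (t + 1)) - f‖ ≤ q * (q * ‖F (u t) - f‖ ^ 2) := by gcongr; exact hres t
        _ = (q * ‖F (u t) - f‖) ^ 2 := by ring
        _ ≤ ((q * r) ^ (2 ^ t)) ^ 2 := by gcongr
        _ = (q * r) ^ (2 ^ (t + 1)) := by rw [← pow_mul, pow_succ]
  intro ε _ T hT
  have herr : lam * ‖u T - uStar‖ ≤ ‖F (u T) - f‖ := by
    rw [← hfix]
    exact mul_norm_le_norm_of_mul_sq_le_inner
      (mul_sq_norm_sub_le_inner_of_coercive_fderiv hF hcoer _ _)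
  refine le_of_mul_le_mul_left ?_ (mul_pos hq0 hlam)
  calc q * lam * ‖u T - uStar‖ = q * (lam * ‖u T - uStar‖) := by ring
    _ ≤ q * ‖F (u T) - f‖ := by gcongr
    _ ≤ lam * q * ε := (hdecay T).trans hT
    _ = q * lam * ε := by ring
end

section
/- Let H be a real Hilbert space and let F : H → H be Fréchet differentiable with derivative F'(u) at each u ∈ H. Let 0 < λ ≤ Λ be real constants such that for all u, v ∈ H one has λ‖v‖ ≤ ‖F'(u) v‖ and ‖F'(u) − F'(v)‖ ≤ Λ‖u − v‖ (operator norm), and suppose that for each u ∈ H the derivative F'(u) is a continuous linear equivalence of H with inverse N(u)⁻¹. Then for every f ∈ H and every u ∈ H, the Newton update u' = u − N(u)⁻¹(F(u) − f) satisfies ‖F(u') − f‖ ≤ (Λ/(2λ²)) · ‖F(u) − f‖². -/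
/-- First-order Taylor estimate: if the derivative varies from its value at `u` at most linearly
with constant `L`, the linearization error at `u` is at most `L / 2 * ‖w‖ ^ 2`. -/
theorem norm_image_add_sub_sub_le_of_hasFDerivAt {E G : Type*} [NormedAddCommGroup E]
    [NormedSpace ℝ E] [NormedAddCommGroup G] [NormedSpace ℝ G] {f : E → G} {f' : E → E →L[ℝ] G}
    (hf : ∀ x, HasFDerivAt f (f' x) x) {L : ℝ} {u : E}
    (hL : ∀ x, ‖f' x - f' u‖ ≤ L * ‖x - u‖) (w : E) :
    ‖f (u + w) - f u - f' u w‖ ≤ L / 2 * ‖w‖ ^ 2 := by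
  have hg (t : ℝ) : HasDerivAt (fun s : ℝ => f (u + s • w) - f u - s • f' u w)
      (f' (u + t • w) w - f' u w) t := by
    have hline : HasDerivAt (fun s : ℝ => u + s • w) w t := by
      simpa using ((hasDerivAt_id t).smul_const w).const_add u
    have hlin : HasDerivAt (fun s : ℝ => s • f' u w) (f' u w) t := by
      simpa using (hasDerivAt_id t).smul_const (f' u w)
    exact (((hf _).comp_hasDerivAt t hline).sub_const (f u)).sub hlin
  have hB (t : ℝ) : HasDerivAt (fun s : ℝ => L / 2 * ‖w‖ ^ 2 * s ^ 2) (L * ‖w‖ ^ 2 * t) t :=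
    ((hasDerivAt_pow 2 t).const_mul (L / 2 * ‖w‖ ^ 2)).congr_deriv (by norm_num; ring)
  have key := image_norm_le_of_norm_deriv_right_le_deriv_boundary (a := 0) (b := 1)
    (fun t _ => (hg t).continuousAt.continuousWithinAt) (fun t _ => (hg t).hasDerivWithinAt)
    (by simp) hB (fun t ht => ?_) (Set.right_mem_Icc.2 zero_le_one)
  · simpa using key
  · calc ‖f' (u + t • w) w - f' u w‖ = ‖(f' (u + t • w) - f' u) w‖ := by simp
      _ ≤ ‖f' (u + t • w) - f' u‖ * ‖w‖ := ContinuousLinearMap.le_opNorm _ _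
      _ ≤ L * ‖u + t • w - u‖ * ‖w‖ := by gcongr; exact hL _
      _ = L * ‖w‖ ^ 2 * t := by
        rw [add_sub_cancel_left, norm_smul, Real.norm_of_nonneg ht.1]
        ring

/-- Single-step quadratic contraction of the Newton residual
(from the proof of the paper's Lemma 1). -/
theorem newton_step_quadratic
    {H : Type*} [NormedAddCommGroup H] [InnerProductSpace ℝ H] [CompleteSpace H]
    (F : H → H) (F' : H → H →L[ℝ] H)
    (hF : ∀ u : H, HasFDerivAt F (F' u) u)
    (lam Lam : ℝ) (hlam : 0 < lam) (hlamLam : lam ≤ Lam)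
    (hlow : ∀ u v : H, lam * ‖v‖ ≤ ‖F' u v‖)
    (hLip : ∀ u v : H, ‖F' u - F' v‖ ≤ Lam * ‖u - v‖)
    (N : H → (H ≃L[ℝ] H)) (hN : ∀ u : H, ((N u : H ≃L[ℝ] H) : H →L[ℝ] H) = F' u)
    (f : H) (u : H) :
    ‖F (u - (N u).symm (F u - f)) - f‖ ≤ (Lam / (2 * lam ^ 2)) * ‖F u - f‖ ^ 2 := by
  set w := (N u).symm (F u - f) with hw
  have hNw : F' u w = F u - f := by
    rw [← hN u]
    simp [hw]
  have hstep : ‖w‖ ≤ ‖F u - f‖ / lam := by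
    rw [le_div_iff₀' hlam, ← hNw]
    exact hlow u w
  have hLam : 0 ≤ Lam := hlam.le.trans hlamLam
  calc ‖F (u - w) - f‖ = ‖F (u + -w) - F u - F' u (-w)‖ := by
        rw [map_neg, hNw, ← sub_eq_add_neg]
        congr 1
        abel
    _ ≤ Lam / 2 * ‖-w‖ ^ 2 := norm_image_add_sub_sub_le_of_hasFDerivAt hF (fun x => hLip x u) _
    _ ≤ Lam / 2 * (‖F u - f‖ / lam) ^ 2 := by
        rw [norm_neg]
        gcongr
    _ = Lam / (2 * lam ^ 2) * ‖F u - f‖ ^ 2 := by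
        field_simp
end

section
/- Let H be a real Hilbert space and let F : H → H be Fréchet differentiable with derivative F'(u) at each u ∈ H. Let 0 < λ ≤ Λ be real constants such that for all u, v ∈ H one has ⟪F'(u) v, v⟫ ≥ λ‖v‖² and ‖F'(u) − F'(v)‖ ≤ Λ‖u − v‖ (operator norm), and suppose that for each u ∈ H the derivative F'(u) is a continuous linear equivalence of H with inverse N(u)⁻¹. Fix f ∈ H and u* ∈ H with F(u*) = f, fix u₀ ∈ H, and define the Newton iterates u_{t+1} = u_t − N(u_t)⁻¹(F(u_t) − f). Set q = Λ/(2λ²) and r = ‖F(u₀) − f‖. Then for every t ∈ ℕ, ‖u_t − u*‖ ≤ (1/λ) · q^(2^t − 1) · r^(2^t). -/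
open scoped RealInnerProductSpace

/-- Second-order Taylor estimate for a map whose derivative is Lipschitz. -/
theorem norm_sub_sub_fderiv_le_of_lipschitz
    {E G : Type*} [NormedAddCommGroup E] [NormedSpace ℝ E]
    [NormedAddCommGroup G] [NormedSpace ℝ G]
    {F : E → G} {F' : E → E →L[ℝ] G} (hF : ∀ u, HasFDerivAt F (F' u) u) {K : ℝ}
    (hLip : ∀ u v, ‖F' u - F' v‖ ≤ K * ‖u - v‖) (x v : E) :
    ‖F (x + v) - F x - F' x v‖ ≤ K / 2 * ‖v‖ ^ 2 := by
  have hline (s : ℝ) : HasDerivAt (fun s : ℝ => x + s • v) v s := by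
    simpa using ((hasDerivAt_id s).smul_const v).const_add x
  have hderiv (s : ℝ) : HasDerivAt (fun s : ℝ => F (x + s • v) - F x - s • F' x v)
      (F' (x + s • v) v - F' x v) s := by
    have h := (((hF (x + s • v)).comp_hasDerivAt s (hline s)).sub_const (F x)).sub
      ((hasDerivAt_id s).smul_const (F' x v))
    rwa [one_smul] at h
  have hbound (s : ℝ) : HasDerivAt (fun s : ℝ => K / 2 * ‖v‖ ^ 2 * s ^ 2)
      (K * ‖v‖ ^ 2 * s) s := by
    have h := (hasDerivAt_pow 2 s).const_mul (K / 2 * ‖v‖ ^ 2)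
    refine h.congr_deriv ?_
    push_cast
    ring
  have h := image_norm_le_of_norm_deriv_right_le_deriv_boundary (a := 0) (b := 1)
    (fun s _ => (hderiv s).continuousAt.continuousWithinAt)
    (fun s _ => (hderiv s).hasDerivWithinAt) (by simp) hbound
    (fun s hs => by
      calc ‖F' (x + s • v) v - F' x v‖ = ‖(F' (x + s • v) - F' x) v‖ := by simp
        _ ≤ ‖F' (x + s • v) - F' x‖ * ‖v‖ := ContinuousLinearMap.le_opNorm _ _
        _ ≤ K * ‖x + s • v - x‖ * ‖v‖ := by gcongr; exact hLip _ _
        _ = K * ‖v‖ ^ 2 * s := by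
          rw [add_sub_cancel_left, norm_smul, Real.norm_of_nonneg hs.1]
          ring)
    (Set.right_mem_Icc.2 zero_le_one)
  simpa using h

/-- If `lam * ‖v‖ ^ 2 ≤ ⟪w, v⟫`, then `lam * ‖v‖ ≤ ‖w‖`. -/
theorem mul_norm_le_norm_of_mul_norm_sq_le_inner
    {H : Type*} [NormedAddCommGroup H] [InnerProductSpace ℝ H] {lam : ℝ} {v w : H}
    (h : lam * ‖v‖ ^ 2 ≤ ⟪w, v⟫) : lam * ‖v‖ ≤ ‖w‖ := by
  rcases (norm_nonneg v).eq_or_lt with hv | hv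
  · simp [← hv]
  · refine le_of_mul_le_mul_right ?_ hv
    calc lam * ‖v‖ * ‖v‖ = lam * ‖v‖ ^ 2 := by ring
      _ ≤ ‖w‖ * ‖v‖ := h.trans (real_inner_le_norm w v)

/-- A map with uniformly coercive derivative is strongly monotone. -/
theorem mul_norm_sq_le_inner_sub_of_coercive_fderiv
    {H : Type*} [NormedAddCommGroup H] [InnerProductSpace ℝ H]
    {F : H → H} {F' : H → H →L[ℝ] H} (hF : ∀ u, HasFDerivAt F (F' u) u) {lam : ℝ}
    (hcoer : ∀ u v : H, lam * ‖v‖ ^ 2 ≤ ⟪F' u v, v⟫) (x y : H) :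
    lam * ‖x - y‖ ^ 2 ≤ ⟪F x - F y, x - y⟫ := by
  have hline (s : ℝ) : HasDerivAt (fun s : ℝ => y + s • (x - y)) (x - y) s := by
    simpa using ((hasDerivAt_id s).smul_const (x - y)).const_add y
  have hderiv (s : ℝ) : HasDerivAt (fun s : ℝ => ⟪F (y + s • (x - y)), x - y⟫)
      ⟪F' (y + s • (x - y)) (x - y), x - y⟫ s := by
    simpa using ((hF (y + s • (x - y))).comp_hasDerivAt s (hline s)).inner ℝ
      (hasDerivAt_const s (x - y))
  obtain ⟨s, -, hs⟩ := exists_hasDerivAt_eq_slope _ _ zero_lt_one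
    (fun s _ => (hderiv s).continuousAt.continuousWithinAt) (fun s _ => hderiv s)
  have h := hcoer (y + s • (x - y)) (x - y)
  rw [hs] at h
  simpa [inner_sub_left] using h

/-- Distance-to-solution bound for Newton's method
(from the end of the proof of the paper's Lemma 1). -/
theorem newton_distance_bound
    {H : Type*} [NormedAddCommGroup H] [InnerProductSpace ℝ H] [CompleteSpace H]
    (F : H → H) (F' : H → H →L[ℝ] H)
    (hF : ∀ u : H, HasFDerivAt F (F' u) u)
    (lam Lam : ℝ) (hlam : 0 < lam) (hlamLam : lam ≤ Lam)
    (hcoer : ∀ u v : H, lam * ‖v‖ ^ 2 ≤ ⟪F' u v, v⟫)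
    (hLip : ∀ u v : H, ‖F' u - F' v‖ ≤ Lam * ‖u - v‖)
    (N : H → (H ≃L[ℝ] H)) (hN : ∀ u : H, ((N u : H ≃L[ℝ] H) : H →L[ℝ] H) = F' u)
    (f uStar : H) (hfix : F uStar = f)
    (u₀ : H) (u : ℕ → H) (hu0 : u 0 = u₀)
    (hstep : ∀ t : ℕ, u (t + 1) = u t - (N (u t)).symm (F (u t) - f))
    (q r : ℝ) (hq : q = Lam / (2 * lam ^ 2)) (hr : r = ‖F u₀ - f‖) :
    ∀ t : ℕ, ‖u t - uStar‖ ≤ (1 / lam) * q ^ (2 ^ t - 1) * r ^ (2 ^ t) := by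
  have hq0 : 0 ≤ q := by
    rw [hq]
    have := hlam.le.trans hlamLam
    positivity
  have hquad (t : ℕ) : ‖F (u (t + 1)) - f‖ ≤ q * ‖F (u t) - f‖ ^ 2 := by
    set s := (N (u t)).symm (F (u t) - f) with hs
    have hNs : F' (u t) s = F (u t) - f := by
      rw [← hN, hs]
      simp
    have hs_le : lam * ‖s‖ ≤ ‖F (u t) - f‖ := by
      rw [← hNs]
      exact mul_norm_le_norm_of_mul_norm_sq_le_inner (hcoer (u t) s)
    have htaylor := norm_sub_sub_fderiv_le_of_lipschitz hF hLip (u t) (-s)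
    rw [map_neg, hNs, ← sub_eq_add_neg, ← hstep t, norm_neg] at htaylor
    calc ‖F (u (t + 1)) - f‖ = ‖F (u (t + 1)) - F (u t) - -(F (u t) - f)‖ := by
          congr 1
          abel
      _ ≤ Lam / 2 * ‖s‖ ^ 2 := htaylor
      _ = q * (lam * ‖s‖) ^ 2 := by
          rw [hq]
          field_simp
      _ ≤ q * ‖F (u t) - f‖ ^ 2 := by gcongr
  have hres (t : ℕ) : ‖F (u t) - f‖ ≤ q ^ (2 ^ t - 1) * r ^ (2 ^ t) := by
    induction t with
    | zero => simp [hu0, hr]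
    | succ t ih =>
      have hexp : 2 ^ (t + 1) - 1 = 2 * (2 ^ t - 1) + 1 := by
        have := Nat.one_le_two_pow (n := t)
        omega
      calc ‖F (u (t + 1)) - f‖ ≤ q * ‖F (u t) - f‖ ^ 2 := hquad t
        _ ≤ q * (q ^ (2 ^ t - 1) * r ^ (2 ^ t)) ^ 2 := by gcongr
        _ = q ^ (2 ^ (t + 1) - 1) * r ^ (2 ^ (t + 1)) := by
          rw [hexp]
          ring
  intro t
  have hdist : lam * ‖u t - uStar‖ ≤ ‖F (u t) - f‖ := by
    rw [← hfix]
    exact mul_norm_le_norm_of_mul_norm_sq_le_inner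
      (mul_norm_sq_le_inner_sub_of_coercive_fderiv hF hcoer (u t) uStar)
  rw [mul_assoc, one_div, ← div_eq_inv_mul, le_div_iff₀' hlam]
  exact hdist.trans (hres t)
end
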